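/- Let R be an associative ring with 1, n ≥ 1, k ≥ 1, and A an n×n matrix over R. Then the k-th right characteristic polynomial p_{A,k}(x) = rdet_{(k)}(x·Iₙ − A) ∈ R[x] has degree at most n^k, and its coefficient of x^{n^k} equals n·((n−1)!)^{1+n+n²+⋯+n^{k−1}}. -/

import Mathlib

/-- The symmetric determinant. -/
def sdet {R : Type*} [Ring R] {n : ℕ} (A : Matrix (Fin n) (Fin n) R) : R :=
  ∑ α : Equiv.Perm (Fin n), ∑ β : Equiv.Perm (Fin n),
    ((Equiv.Perm.sign α * Equiv.Perm.sign β : ℤˣ) : ℤ) •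
      (List.ofFn fun i => A (α i) (β i)).prod

/-- The symmetric adjoint. -/
def sadj {R : Type*} [Ring R] {n : ℕ} (A : Matrix (Fin (n + 1)) (Fin (n + 1)) R) :
    Matrix (Fin (n + 1)) (Fin (n + 1)) R :=
  fun r s => (-1 : R) ^ ((r : ℕ) + (s : ℕ)) * sdet (A.submatrix s.succAbove r.succAbove)

/-- `adjAux A j = (P_j, P₁ * ⋯ * P_j)` where `(P_j)` is the right adjoint sequence of `A`. -/
def adjAux {R : Type*} [Ring R] {n : ℕ} (A : Matrix (Fin (n + 1)) (Fin (n + 1)) R) :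
    ℕ → Matrix (Fin (n + 1)) (Fin (n + 1)) R × Matrix (Fin (n + 1)) (Fin (n + 1)) R
  | 0 => (1, 1)
  | j + 1 =>
      let q := adjAux A j
      let p := sadj (A * q.2)
      (p, q.2 * p)

/-- The product `P₁ * ⋯ * P_k` of the right adjoint sequence of `A`. -/
def radjProd {R : Type*} [Ring R] {n : ℕ} (A : Matrix (Fin (n + 1)) (Fin (n + 1)) R)
    (k : ℕ) : Matrix (Fin (n + 1)) (Fin (n + 1)) R :=
  (adjAux A k).2

/-- The `k`-th right adjoint `radj_{(k)}(A) = n • (P₁ * ⋯ * P_k)`. -/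
def radj {R : Type*} [Ring R] {n : ℕ} (A : Matrix (Fin (n + 1)) (Fin (n + 1)) R)
    (k : ℕ) : Matrix (Fin (n + 1)) (Fin (n + 1)) R :=
  (n + 1) • radjProd A k

/-- The `k`-th right determinant `rdet_{(k)}(A) = tr (A * P₁ * ⋯ * P_k)`. -/
def rdet {R : Type*} [Ring R] {n : ℕ} (A : Matrix (Fin (n + 1)) (Fin (n + 1)) R)
    (k : ℕ) : R :=
  (A * radjProd A k).trace

/-- The `k`-th right characteristic polynomial `p_{A,k}(x) = rdet_{(k)}(x Iₙ - A)`. -/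
noncomputable def rcharpoly {R : Type*} [Ring R] {n : ℕ}
    (A : Matrix (Fin (n + 1)) (Fin (n + 1)) R) (k : ℕ) : Polynomial R :=
  rdet ((Polynomial.X : Polynomial R) • (1 : Matrix (Fin (n + 1)) (Fin (n + 1)) (Polynomial R))
    - A.map Polynomial.C) k

/-- The product of the entries of a list of polynomials of degree at most `d` has degree at most
`m * d`, and its coefficient there is the product of the coefficients. -/
lemma natDegree_coeff_prod_ofFn {R : Type*} [Ring R] (d : ℕ) {m : ℕ}
    (f : Fin m → Polynomial R) (hf : ∀ i, (f i).natDegree ≤ d) :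
    (List.ofFn f).prod.natDegree ≤ m * d ∧
      (List.ofFn f).prod.coeff (m * d) = (List.ofFn fun i => (f i).coeff d).prod := by
  induction m with
  | zero => simp
  | succ m ih =>
    obtain ⟨h1, h2⟩ := ih (fun i => f i.succ) fun i => hf _
    rw [List.ofFn_succ, List.prod_cons, List.ofFn_succ, List.prod_cons, ← h2,
      Nat.succ_mul, add_comm (m * d) d]
    exact ⟨Polynomial.natDegree_mul_le_of_le (hf 0) h1,
      Polynomial.coeff_mul_add_eq_of_natDegree_le (hf 0) h1⟩

/-- Over a commutative ring the symmetric determinant is `m!` times the determinant. -/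
lemma sdet_eq_factorial_mul_det {S : Type*} [CommRing S] {m : ℕ}
    (B : Matrix (Fin m) (Fin m) S) : sdet B = m.factorial * B.det := by
  have key (β : Equiv.Perm (Fin m)) :
      ∑ α : Equiv.Perm (Fin m), ((Equiv.Perm.sign α * Equiv.Perm.sign β : ℤˣ) : ℤ) •
        (List.ofFn fun i => B (α i) (β i)).prod = B.det := by
    have h := Matrix.det_permute' β B
    rw [Matrix.det_apply'] at h
    have h2 : ((Equiv.Perm.sign β : ℤ) : S) * ((Equiv.Perm.sign β : ℤ) : S) = 1 := by
      rw [← Int.cast_mul, ← Units.val_mul, Int.units_mul_self]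
      simp
    rw [← one_mul B.det, ← h2, mul_assoc, ← h, Finset.mul_sum]
    refine Finset.sum_congr rfl fun α _ => ?_
    simp only [List.prod_ofFn, zsmul_eq_mul, Units.val_mul, Int.cast_mul, Matrix.submatrix_apply,
      id_eq]
    ring
  rw [sdet, Finset.sum_comm, Finset.sum_congr rfl fun β _ => key β]
  simp [Fintype.card_perm]

/-- Over a commutative ring the symmetric adjoint is `n!` times the adjugate. -/
lemma sadj_eq_factorial_smul_adjugate {S : Type*} [CommRing S] {n : ℕ}
    (B : Matrix (Fin (n + 1)) (Fin (n + 1)) S) :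
    sadj B = (n.factorial : S) • B.adjugate := by
  ext r s
  rw [sadj, sdet_eq_factorial_mul_det, Matrix.smul_apply, smul_eq_mul,
    Matrix.adjugate_fin_succ_eq_det_submatrix, add_comm]
  ring

/-- The entries of `M` have degree at most `d`, with coefficients at `d` given by the integer
matrix `B`. -/
def HasTopCoeff {R : Type*} [Ring R] {m : ℕ} (M : Matrix (Fin m) (Fin m) (Polynomial R)) (d : ℕ)
    (B : Matrix (Fin m) (Fin m) ℤ) : Prop :=
  ∀ i j, (M i j).natDegree ≤ d ∧ (M i j).coeff d = (B i j : R)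

lemma HasTopCoeff.mul {R : Type*} [Ring R] {m d e : ℕ}
    {M N : Matrix (Fin m) (Fin m) (Polynomial R)} {B C : Matrix (Fin m) (Fin m) ℤ}
    (hM : HasTopCoeff M d B) (hN : HasTopCoeff N e C) : HasTopCoeff (M * N) (d + e) (B * C) := by
  intro i j
  rw [Matrix.mul_apply, Matrix.mul_apply]
  refine ⟨Polynomial.natDegree_sum_le_of_forall_le _ _ fun l _ =>
    Polynomial.natDegree_mul_le_of_le (hM i l).1 (hN l j).1, ?_⟩
  rw [Polynomial.finsetSum_coeff, Int.cast_sum]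
  refine Finset.sum_congr rfl fun l _ => ?_
  rw [Polynomial.coeff_mul_add_eq_of_natDegree_le (hM i l).1 (hN l j).1, (hM i l).2, (hN l j).2,
    Int.cast_mul]

lemma HasTopCoeff.natDegree_coeff_sdet {R : Type*} [Ring R] {m d : ℕ}
    {M : Matrix (Fin m) (Fin m) (Polynomial R)} {B : Matrix (Fin m) (Fin m) ℤ}
    (hM : HasTopCoeff M d B) :
    (sdet M).natDegree ≤ m * d ∧ (sdet M).coeff (m * d) = ((sdet B : ℤ) : R) := by
  have h (α β : Equiv.Perm (Fin m)) :=
    natDegree_coeff_prod_ofFn d (fun i => M (α i) (β i)) fun i => (hM _ _).1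
  constructor
  · refine Polynomial.natDegree_sum_le_of_forall_le _ _ fun α _ =>
      Polynomial.natDegree_sum_le_of_forall_le _ _ fun β _ => ?_
    exact (Polynomial.natDegree_smul_le _ _).trans (h α β).1
  · simp only [sdet, Polynomial.finsetSum_coeff, Int.cast_sum]
    refine Finset.sum_congr rfl fun α _ => Finset.sum_congr rfl fun β _ => ?_
    rw [Polynomial.coeff_smul, (h α β).2, smul_eq_mul, Int.cast_mul, zsmul_eq_mul]
    simp only [(hM _ _).2]
    congr 1
    refine Eq.trans ?_ (map_list_prod (Int.castRingHom R) _).symm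
    rw [List.map_ofFn]
    rfl

lemma HasTopCoeff.symmetric_adjoint {R : Type*} [Ring R] {n d : ℕ}
    {M : Matrix (Fin (n + 1)) (Fin (n + 1)) (Polynomial R)}
    {B : Matrix (Fin (n + 1)) (Fin (n + 1)) ℤ} (hM : HasTopCoeff M d B) :
    HasTopCoeff (sadj M) (n * d) (sadj B) := by
  intro r s
  have h := HasTopCoeff.natDegree_coeff_sdet (M := M.submatrix s.succAbove r.succAbove)
    (B := B.submatrix s.succAbove r.succAbove) fun i j => hM _ _
  unfold sadj
  rcases neg_one_pow_eq_or ℤ ((r : ℕ) + s) with hs | hs <;>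
  rcases Nat.even_or_odd ((r : ℕ) + s) with he | he <;>
  simp_all [he.neg_one_pow]

/-- The matrices `A * P₁ * ⋯ * P_k` for `A` with linear entries and top coefficient `1`. -/
lemma HasTopCoeff.mul_radjProd {R : Type*} [Ring R] {n : ℕ}
    {M : Matrix (Fin (n + 1)) (Fin (n + 1)) (Polynomial R)} (hM : HasTopCoeff M 1 1) (k : ℕ) :
    HasTopCoeff (M * radjProd M k) ((n + 1) ^ k)
      (((n.factorial : ℤ) ^ (∑ i ∈ Finset.range k, (n + 1) ^ i)) • 1) := by
  induction k with
  | zero => simpa [radjProd, adjAux] using hM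
  | succ k ih =>
    have h := ih.mul ih.symmetric_adjoint
    rw [sadj_eq_factorial_smul_adjugate, Matrix.adjugate_smul, Matrix.adjugate_one] at h
    convert h using 1
    · exact (mul_assoc _ _ _).symm
    · ring
    · rw [geom_sum_succ]
      simp only [Fintype.card_fin, Nat.add_sub_cancel, smul_mul_smul_comm, smul_smul, mul_one]
      congr 1
      ring

/-- The `k`-th right characteristic polynomial `p_{A,k}(x) = rdet_{(k)}(x·Iₙ − A)` of an
`n×n` matrix `A` (`n ≥ 1`, `k ≥ 1`) has degree at most `n^k`, and its coefficient of
`x^(n^k)` is `n·((n−1)!)^(1+n+n²+⋯+n^(k−1))`. -/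
theorem rcharpoly_natDegree_le_and_leadingCoeff
    (R : Type*) [Ring R] (n k : ℕ) (hk : 1 ≤ k)
    (A : Matrix (Fin (n + 1)) (Fin (n + 1)) R) :
    (rcharpoly A k).natDegree ≤ (n + 1) ^ k ∧
      (rcharpoly A k).coeff ((n + 1) ^ k) =
        (((n + 1) * Nat.factorial n ^ (∑ i ∈ Finset.range k, (n + 1) ^ i) : ℕ) : R) := by
  have hM : HasTopCoeff ((Polynomial.X : Polynomial R) •
      (1 : Matrix (Fin (n + 1)) (Fin (n + 1)) (Polynomial R)) - A.map Polynomial.C) 1 1 := by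
    intro i j
    rcases eq_or_ne i j with rfl | hij
    · exact ⟨by simpa using Polynomial.natDegree_X_le, by simp⟩
    · simp [hij]
  have h := hM.mul_radjProd k
  rw [rcharpoly, rdet, Matrix.trace]
  refine ⟨Polynomial.natDegree_sum_le_of_forall_le _ _ fun i _ => (h i i).1, ?_⟩
  rw [Polynomial.finsetSum_coeff]
  simp only [Matrix.diag_apply, (h _ _).2]
  simp
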